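/- Correctness of the Heap-Counting approach: let x be a string of length m ≥ 2 over an alphabet Σ (modeled as a list over a type α), let Σ_x be the (finite) set of characters occurring in x, of size σ_x, and let f be a bijection from Σ_x to {0, 1, …, σ_x − 1}. Define the heap mapping h : α → ℕ by h(c) = m^{f(c)} if c ∈ Σ_x and h(c) = 0 otherwise, and let δ = Σ_{i=0}^{m−1} h(x[i]). Then for every string w of length m over α, the multiset of characters of w equals the multiset of characters of x if and only if Σ_{i=0}^{m−1} h(w[i]) = δ. In particular, for a text y of length n, the set of abelian occurrences of x in y equals { s : 0 ≤ s ≤ n − m and Σ_{i=0}^{m−1} h(y[s+i]) = δ }. -/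

import Mathlib

theorem heap_aux (m : ℕ) (hm : 2 ≤ m) : ∀ (k : ℕ) (a b : Fin k → ℕ) (q : ℕ),
    (∀ i, a i < m) → ∑ i, a i * m ^ (i : ℕ) = q + ∑ i, b i * m ^ (i : ℕ) →
    q + ∑ i, b i ≤ ∑ i, a i →
    (∑ i, a i = q + ∑ i, b i) ∧ (q = 0 → ∀ i, a i = b i) := by
  intro k
  induction k with
  | zero =>
    intro a b q _ _ h3
    refine ⟨?_, fun _ i => i.elim0⟩
    simp at h3 ⊢
    omega
  | succ k ih =>
    intro a b q h1 h2 h3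
    have key : ∀ g : Fin (k+1) → ℕ, ∑ i, g i * m ^ (i : ℕ)
        = g 0 + m * ∑ i : Fin k, g i.succ * m ^ (i : ℕ) := by
      intro g
      rw [Fin.sum_univ_succ, Finset.mul_sum]
      simp only [Fin.val_zero, pow_zero, mul_one, Fin.val_succ]
      congr 1
      exact Finset.sum_congr rfl fun i _ => by ring
    rw [key, key] at h2
    rw [Fin.sum_univ_succ, Fin.sum_univ_succ] at h3 ⊢
    set A := ∑ i : Fin k, a i.succ * m ^ (i : ℕ) with hA
    set B := ∑ i : Fin k, b i.succ * m ^ (i : ℕ) with hB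
    have hmod : (q + b 0) % m = a 0 := by
      have := congrArg (· % m) h2
      simp only [← add_assoc, Nat.add_mul_mod_self_left] at this
      rw [← this, Nat.mod_eq_of_lt (h1 0)]
    have hdiv := Nat.mod_add_div (q + b 0) m
    rw [hmod] at hdiv
    set r := (q + b 0) / m with hr
    have hAB : A = r + B := by
      have : m * A = m * (r + B) := by rw [mul_add]; omega
      exact Nat.eq_of_mul_eq_mul_left (by omega) this
    have hrm : 2 * r ≤ m * r := Nat.mul_le_mul_right r hm
    obtain ⟨i1, i2⟩ := ih (fun i => a i.succ) (fun i => b i.succ) r (fun i => h1 _) hAB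
      (by omega)
    have r0 : r = 0 := by omega
    rw [r0] at hdiv i1
    simp only [mul_zero, zero_add, add_zero] at hdiv i1
    refine ⟨by omega, fun hq i => ?_⟩
    refine Fin.cases ?_ (fun j => i2 r0 j) i
    omega

theorem heap_sum {α : Type*} [DecidableEq α] (S : Finset α) (h : α → ℕ)
    (h0 : ∀ c, c ∉ S → h c = 0) (w : List α) :
    (w.map h).sum = ∑ c ∈ S, w.count c * h c := by
  induction w with
  | nil => simp
  | cons d w ih =>
    simp only [List.map_cons, List.sum_cons, ih, List.count_cons, add_mul, Finset.sum_add_distrib,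
      beq_iff_eq, ite_mul, one_mul, zero_mul, Finset.sum_ite_eq]
    by_cases hd : d ∈ S
    · simp [hd, add_comm]
    · simp [hd, h0 d hd]

theorem heap_len {α : Type*} [DecidableEq α] (S : Finset α) (w : List α) :
    ∑ c ∈ S, w.count c ≤ w.length := by
  induction w with
  | nil => simp
  | cons d w ih =>
    simp only [List.count_cons, Finset.sum_add_distrib, beq_iff_eq, Finset.sum_ite_eq,
      List.length_cons]
    split_ifs <;> omega


/-- Correctness of the Heap-Counting approach: let `x` have length `m ≥ 2`, let
`f` be a bijection from the set of characters occurring in `x` onto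
`{0, …, σ_x − 1}`, and let `h c = m ^ f c` for `c` occurring in `x` and `h c = 0`
otherwise, with `δ = Σ_i h (x[i])`.  Then a string `w` of length `m` has the same
multiset of characters as `x` iff its heap value equals `δ`; in particular the
abelian occurrences of `x` in a text `y` of length `n` are exactly the positions
`s ≤ n − m` whose window heap value equals `δ`. -/
theorem heap_counting_correctness
    {α : Type*} [DecidableEq α] (x : List α) (m : ℕ)
    (hx : x.length = m) (hm : 2 ≤ m)
    (f : {c : α // c ∈ x.toFinset} → Fin x.toFinset.card)
    (hf : Function.Bijective f)
    (h : α → ℕ)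
    (hh : ∀ c : α,
      h c = if hc : c ∈ x.toFinset then m ^ ((f ⟨c, hc⟩ : Fin x.toFinset.card) : ℕ) else 0)
    (δ : ℕ) (hδ : δ = (x.map h).sum) :
    (∀ w : List α, w.length = m →
        (((w : Multiset α) = (x : Multiset α)) ↔ (w.map h).sum = δ)) ∧
    (∀ (y : List α) (n : ℕ), y.length = n →
        {s : ℕ | s ≤ n - m ∧ (((y.drop s).take m : List α) : Multiset α) = (x : Multiset α)} =
          {s : ℕ | s ≤ n - m ∧ (((y.drop s).take m).map h).sum = δ}) := by

  have main : ∀ w : List α, w.length ≤ m →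
      (((w : Multiset α) = (x : Multiset α)) ↔ (w.map h).sum = δ) := by
    intro w hw
    constructor
    · intro e
      rw [hδ]
      exact ((Multiset.coe_eq_coe.1 e).map h).sum_eq
    intro e
    have h0 : ∀ c, c ∉ x.toFinset → h c = 0 := fun c hc => by rw [hh, dif_neg hc]
    let E := Equiv.ofBijective f hf
    have tr : ∀ g : α → ℕ, ∑ c ∈ x.toFinset, g c = ∑ i, g (E.symm i).1 := by
      intro g
      rw [← Finset.sum_coe_sort]
      exact (Equiv.sum_comp E.symm (fun c => g c.1)).symm
    have hE : ∀ i, h (E.symm i).1 = m ^ (i : ℕ) := by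
      intro i
      rw [hh, dif_pos (E.symm i).2]
      congr 2
      exact E.apply_symm_apply i
    have hsum : ∑ i, x.count (E.symm i).1 * m ^ (i : ℕ)
        = ∑ i, w.count (E.symm i).1 * m ^ (i : ℕ) := by
      rw [hδ, heap_sum _ h h0 w, heap_sum _ h h0 x, tr, tr] at e
      simp only [hE] at e
      exact e.symm
    have hxl : ∑ i, x.count (E.symm i).1 = m := by
      rw [← tr (fun c => x.count c), ← hx]
      exact List.sum_toFinset_count_eq_length x
    have hwl : ∑ i, w.count (E.symm i).1 ≤ m := by
      rw [← tr (fun c => w.count c)]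
      exact (heap_len _ w).trans hw
    have hcount : ∀ i, x.count (E.symm i).1 = w.count (E.symm i).1 := by
      by_cases hlt : ∀ i, x.count (E.symm i).1 < m
      · exact (heap_aux m hm _ _ (fun i => w.count (E.symm i).1) 0 hlt (by simpa using hsum)
          (by simp only [zero_add]; omega)).2 rfl
      · push Not at hlt
        obtain ⟨i, hi⟩ := hlt
        have hc : x.count (E.symm i).1 = x.length :=
          le_antisymm List.count_le_length (hx ▸ hi)
        rw [List.count_eq_length] at hc
        have hu : ∀ j, j = i := by
          intro j
          apply E.symm.injective
          apply Subtype.ext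
          exact (hc _ (List.mem_toFinset.1 (E.symm j).2)).symm
        have hi0 : (i : ℕ) = 0 := by
          have := hu ⟨0, i.pos⟩
          rw [← this]
        rw [Fintype.sum_eq_single i (fun j hj => absurd (hu j) hj),
          Fintype.sum_eq_single i (fun j hj => absurd (hu j) hj)] at hsum
        intro j
        rw [hu j]
        simpa [hi0] using hsum
    symm
    apply Multiset.eq_of_le_of_card_le
    · rw [Multiset.le_iff_count]
      intro c
      simp only [Multiset.coe_count]
      by_cases hc : c ∈ x.toFinset
      · have := hcount (E ⟨c, hc⟩)
        simp only [Equiv.symm_apply_apply] at this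
        exact this.le
      · rw [List.count_eq_zero_of_not_mem (fun h' => hc (List.mem_toFinset.2 h'))]
        exact Nat.zero_le _
    · simp only [Multiset.coe_card]; omega
  refine ⟨fun w hw => main w hw.le, fun y n _ => ?_⟩
  ext s
  simp only [Set.mem_ofPred_eq]
  rw [main _ (by simp)]
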